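/- Let (S, Σ, κ) be a stochastic transition system and B ∈ Σ, and let κ_B be the Markov kernel obtained from κ by making B absorbing, i.e., κ_B(s, ·) = δ_s for s ∈ B and κ_B(s, ·) = κ(s, ·) for s ∉ B. Then for every initial distribution μ on S: (i) the probability under κ of ever reaching B equals the probability under κ_B of eventually staying in B forever, i.e., P^κ_μ(F B) = P^{κ_B}_μ(FG B); and (ii) for every measurable A ⊆ S with A ∩ B = ∅, P^κ_μ(G (S∖B) ∩ GF A) ≤ P^{κ_B}_μ(GF A). -/

import Mathlib

open MeasureTheory ProbabilityTheory Filter Set Topology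

/-- Prepend one state to an infinite run. -/
def prep {S : Type*} (s : S) (ρ : ℕ → S) : ℕ → S
  | 0 => s
  | n + 1 => ρ n

/-- Prepend a finite word to an infinite run. -/
def prepList {S : Type*} (l : List S) (ρ : ℕ → S) : ℕ → S := fun n =>
  if h : n < l.length then l.get ⟨n, h⟩ else ρ (n - l.length)

/-- `E` is a tail event: membership is not affected by changing a finite prefix. -/
def IsTailEvent {S : Type*} (E : Set (ℕ → S)) : Prop :=
  ∀ (l : List S) (ρ : ℕ → S), ρ ∈ E ↔ prepList l ρ ∈ E

/-- Cylinder `Cyl A n = {ρ | ρ k ∈ A k for all k < n}` (built from `A 0, …, A (n-1)`). -/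
def Cyl {S : Type*} (A : ℕ → Set S) (n : ℕ) : Set (ℕ → S) := {ρ | ∀ k < n, ρ k ∈ A k}

/-- Event `F B`: eventually reach `B`. -/
def FEv {S : Type*} (B : Set S) : Set (ℕ → S) := {ρ | ∃ n, ρ n ∈ B}

/-- Event `F^{≤ m} B`: reach `B` within `m` steps. -/
def FleEv {S : Type*} (m : ℕ) (B : Set S) : Set (ℕ → S) := {ρ | ∃ n ≤ m, ρ n ∈ B}

/-- Event `G B`: always in `B`. -/
def GEv {S : Type*} (B : Set S) : Set (ℕ → S) := {ρ | ∀ n, ρ n ∈ B}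

/-- Event `GF B`: visit `B` infinitely often. -/
def GFEv {S : Type*} (B : Set S) : Set (ℕ → S) := {ρ | ∀ i, ∃ j ≥ i, ρ j ∈ B}

/-- Event `FG B`: eventually always in `B`. -/
def FGEv {S : Type*} (B : Set S) : Set (ℕ → S) := {ρ | ∃ i, ∀ j ≥ i, ρ j ∈ B}

/-- Event `GF φ_𝒜`: the pattern `A 0, …, A n` occurs at infinitely many positions. -/
def GFPat {S : Type*} (A : ℕ → Set S) (n : ℕ) : Set (ℕ → S) :=
  {ρ | ∀ i, ∃ j ≥ i, ∀ k ≤ n, ρ (j + k) ∈ A k}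

/-- Event `A U B`. -/
def UntilEv {S : Type*} (A B : Set S) : Set (ℕ → S) :=
  {ρ | ∃ n, ρ n ∈ B ∧ ∀ k < n, ρ k ∈ A}

/-- Event `A U^{≤ m} B`. -/
def UntilLeEv {S : Type*} (m : ℕ) (A B : Set S) : Set (ℕ → S) :=
  {ρ | ∃ n ≤ m, ρ n ∈ B ∧ ∀ k < n, ρ k ∈ A}

/-- The filtration `F n`: σ-algebra generated by the cylinders of length `n`,
i.e., by the first `n` coordinates. -/
def cylFiltration (S : Type*) [MeasurableSpace S] (n : ℕ) : MeasurableSpace (ℕ → S) :=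
  MeasurableSpace.comap (fun ρ (i : Fin n) => ρ i) inferInstance

/-- `P` is the family of path measures of the STS `(S, Σ, κ)` given by the
Ionescu–Tulcea construction: for every initial probability distribution `μ`,
`P μ` is a probability measure on runs, and `P` satisfies the Markov property
(`s₀ ∼ μ`, and the rest of the run follows the chain started in `κ s₀`),
which uniquely characterizes the Ionescu–Tulcea path measures. -/
def IsPathMeasure {S : Type*} [MeasurableSpace S] (κ : Kernel S S)
    (P : Measure S → Measure (ℕ → S)) : Prop :=
  (∀ μ : Measure S, IsProbabilityMeasure μ → IsProbabilityMeasure (P μ)) ∧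
  (∀ μ : Measure S, IsProbabilityMeasure μ →
    P μ = μ.bind fun s => (P (κ s)).map (prep s))

/-- `B̃`: the set of states from which `B` is reached with probability zero. -/
def Btilde {S : Type*} [MeasurableSpace S] (P : Measure S → Measure (ℕ → S)) (B : Set S) :
    Set S := {s | P (Measure.dirac s) (FEv B) = 0}

/-- The STS with path measures `P` is decisive w.r.t. `B`. -/
def Decisive {S : Type*} [MeasurableSpace S] (P : Measure S → Measure (ℕ → S)) (B : Set S) :
    Prop := ∀ μ : Measure S, IsProbabilityMeasure μ → P μ (FEv B ∪ FEv (Btilde P B)) = 1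

/-- `ν_{A₀,…,Aₙ}`: the distribution of the `n`-th state under `P ν` conditioned on
the cylinder `Cyl A (n+1)`. -/
noncomputable def condDist {S : Type*} [MeasurableSpace S]
    (P : Measure S → Measure (ℕ → S)) (ν : Measure S) (A : ℕ → Set S) (n : ℕ) : Measure S :=
  (ProbabilityTheory.cond (P ν) (Cyl A (n + 1))).map fun ρ => ρ n

lemma measurable_prep {S : Type*} [MeasurableSpace S] (s : S) : Measurable (prep s) := by
  refine measurable_pi_lambda _ fun n => ?_
  cases n with
  | zero => exact measurable_const
  | succ n => exact measurable_pi_apply n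

lemma measurableSet_Cyl {S : Type*} [MeasurableSpace S] {A : ℕ → Set S}
    (hA : ∀ k, MeasurableSet (A k)) (n : ℕ) : MeasurableSet (Cyl A n) := by
  simp only [Cyl, ofPred_forall]
  exact .iInter fun k => .iInter fun _ => measurable_pi_apply k (hA k)

namespace IsPathMeasure

variable {S : Type*} [MeasurableSpace S] {κ : Kernel S S} {P : Measure S → Measure (ℕ → S)}

/-- `Measure.bind` along a map that is not a.e. measurable is zero, so the Markov property
of a family of probability measures forces a.e. measurability. -/
lemma aemeasurable (hP : IsPathMeasure κ P) (μ : Measure S) [hμ : IsProbabilityMeasure μ] :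
    AEMeasurable (fun s => (P (κ s)).map (prep s)) μ := by
  by_contra h
  have := hP.1 μ hμ
  apply IsProbabilityMeasure.ne_zero (P μ)
  rw [hP.2 μ hμ, Measure.bind, Measure.map_of_not_aemeasurable h, Measure.join_zero]

lemma apply_eq_lintegral (hP : IsPathMeasure κ P) (μ : Measure S) [hμ : IsProbabilityMeasure μ]
    {E : Set (ℕ → S)} (hE : MeasurableSet E) :
    P μ E = ∫⁻ s, P (κ s) (prep s ⁻¹' E) ∂μ := by
  rw [hP.2 μ hμ, Measure.bind_apply hE (hP.aemeasurable μ)]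
  exact lintegral_congr fun s => Measure.map_apply (measurable_prep s) hE

lemma apply_zero_mem [IsMarkovKernel κ] (hP : IsPathMeasure κ P) (μ : Measure S)
    [IsProbabilityMeasure μ] {C : Set S} (hC : MeasurableSet C) :
    P μ {ρ | ρ 0 ∈ C} = μ C := by
  have hmeas : MeasurableSet {ρ : ℕ → S | ρ 0 ∈ C} := measurable_pi_apply 0 hC
  rw [hP.apply_eq_lintegral μ hmeas, ← lintegral_indicator_one hC]
  refine lintegral_congr fun s => ?_
  have := hP.1 (κ s) inferInstance
  by_cases h : s ∈ C <;> simp [h, prep]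

/-- A chain whose states in `B` are absorbing almost surely never leaves `B`. -/
lemma ae_mem_succ_of_absorbing [IsMarkovKernel κ] (hP : IsPathMeasure κ P) {B : Set S}
    (hB : MeasurableSet B) (hκ : ∀ s ∈ B, κ s = Measure.dirac s) (n : ℕ) (μ : Measure S)
    [IsProbabilityMeasure μ] : P μ {ρ | ρ n ∈ B ∧ ρ (n + 1) ∉ B} = 0 := by
  have hmeas (n : ℕ) : MeasurableSet {ρ : ℕ → S | ρ n ∈ B ∧ ρ (n + 1) ∉ B} :=
    (measurable_pi_apply n hB).inter (measurable_pi_apply (n + 1) hB).compl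
  induction n generalizing μ with
  | zero =>
    rw [hP.apply_eq_lintegral μ (hmeas 0)]
    refine (lintegral_congr fun s => ?_).trans lintegral_zero
    by_cases h : s ∈ B
    · have := hP.apply_zero_mem (κ s) hB.compl
      rw [hκ s h, Measure.dirac_apply' _ hB.compl] at this
      simpa [h, prep, hκ s h] using this
    · simp [h, prep]
  | succ n ih =>
    rw [hP.apply_eq_lintegral μ (hmeas (n + 1))]
    exact (lintegral_congr fun s => ih (κ s)).trans lintegral_zero

lemma apply_FGEv_of_absorbing [IsMarkovKernel κ] (hP : IsPathMeasure κ P) {B : Set S}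
    (hB : MeasurableSet B) (hκ : ∀ s ∈ B, κ s = Measure.dirac s) (μ : Measure S)
    [IsProbabilityMeasure μ] : P μ (FGEv B) = P μ (FEv B) := by
  refine le_antisymm (measure_mono fun ρ ⟨i, hi⟩ => ⟨i, hi i le_rfl⟩) (measure_mono_ae ?_)
  have h : ∀ᵐ ρ ∂P μ, ∀ n, ρ n ∈ B → ρ (n + 1) ∈ B := by
    refine ae_all_iff.2 fun n => ?_
    simpa [ae_iff] using hP.ae_mem_succ_of_absorbing hB hκ n μ
  filter_upwards [h] with ρ hρ
  rintro ⟨n, hn⟩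
  exact ⟨n, fun j hj => Nat.le_induction hn (fun k _ => hρ k) j hj⟩

variable {κ' : Kernel S S} {P' : Measure S → Measure (ℕ → S)} {B : Set S}

/-- Two chains with the same transitions from outside `B` agree on finite-horizon events
until `B` is reached. -/
lemma apply_inter_Cyl_compl_congr [IsMarkovKernel κ] [IsMarkovKernel κ'] (hP : IsPathMeasure κ P)
    (hP' : IsPathMeasure κ' P') (hB : MeasurableSet B) (hκ : ∀ s ∉ B, κ' s = κ s) (n : ℕ)
    {E : Set (ℕ → S)} (hE : MeasurableSet E) (hdep : DependsOn (· ∈ E) (Iio n))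
    (μ : Measure S) [hμ : IsProbabilityMeasure μ] :
    P μ (E ∩ Cyl (fun _ => Bᶜ) n) = P' μ (E ∩ Cyl (fun _ => Bᶜ) n) := by
  have hCyl := measurableSet_Cyl (A := fun _ => Bᶜ) fun _ => hB.compl
  induction n generalizing E μ with
  | zero =>
    have := hP.1 μ hμ
    have := hP'.1 μ hμ
    have hconst : ∀ ρ ρ' : ℕ → S, ρ ∈ E → ρ' ∈ E := fun ρ ρ' h =>
      (hdep (x := ρ) (y := ρ') (by simp)).mp h
    obtain rfl | ⟨ρ, hρ⟩ := E.eq_empty_or_nonempty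
    · simp
    · simp [Cyl, eq_univ_of_forall fun ρ' => hconst ρ ρ' hρ]
  | succ n ih =>
    rw [hP.apply_eq_lintegral μ (hE.inter (hCyl _)), hP'.apply_eq_lintegral μ (hE.inter (hCyl _))]
    refine lintegral_congr fun s => ?_
    by_cases hs : s ∈ B
    · have : prep s ⁻¹' (E ∩ Cyl (fun _ => Bᶜ) (n + 1)) = ∅ :=
        eq_empty_of_forall_notMem fun ρ hρ => hρ.2 0 n.succ_pos hs
      simp [this]
    · have : prep s ⁻¹' (E ∩ Cyl (fun _ => Bᶜ) (n + 1)) =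
          prep s ⁻¹' E ∩ Cyl (fun _ => Bᶜ) n := by
        ext ρ
        refine and_congr_right fun _ => ⟨fun h k hk => h (k + 1) (by omega), fun h k hk => ?_⟩
        cases k with
        | zero => exact hs
        | succ k => exact h k (by omega)
      rw [this, hκ s hs]
      refine ih (measurable_prep s hE) (fun ρ ρ' h => hdep fun k hk => ?_) (κ s)
      cases k with
      | zero => rfl
      | succ k => exact h k (by simpa using hk)

/-- Two chains with the same transitions from outside `B` agree on the runs avoiding `B`. -/
lemma restrict_GEv_compl_congr [IsMarkovKernel κ] [IsMarkovKernel κ'] (hP : IsPathMeasure κ P)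
    (hP' : IsPathMeasure κ' P') (hB : MeasurableSet B) (hκ : ∀ s ∉ B, κ' s = κ s)
    (μ : Measure S) [hμ : IsProbabilityMeasure μ] :
    (P μ).restrict (GEv Bᶜ) = (P' μ).restrict (GEv Bᶜ) := by
  have := hP.1 μ hμ
  have := hP'.1 μ hμ
  have hCyl := measurableSet_Cyl (A := fun _ => Bᶜ) fun _ => hB.compl
  have hG : GEv Bᶜ = ⋂ n, Cyl (fun _ => Bᶜ) n := by
    ext ρ
    simp only [GEv, Cyl, mem_iInter, mem_ofPred_eq]
    exact ⟨fun h n k _ => h k, fun h n => h (n + 1) n n.lt_succ_self⟩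
  have key : ∀ E ∈ measurableCylinders fun _ : ℕ => S,
      (P μ).restrict (GEv Bᶜ) E = (P' μ).restrict (GEv Bᶜ) E := by
    intro E hE
    have hEm : MeasurableSet E := .of_mem_measurableCylinders hE
    obtain ⟨s, T, -, rfl⟩ := (mem_measurableCylinders E).1 hE
    have htend (Q : Measure (ℕ → S)) [IsFiniteMeasure Q] :
        Tendsto (fun n => Q (cylinder s T ∩ Cyl (fun _ => Bᶜ) n)) atTop
          (𝓝 (Q (cylinder s T ∩ GEv Bᶜ))) := by
      rw [hG, inter_iInter]
      refine tendsto_measure_iInter_atTop (fun n => (hEm.inter (hCyl n)).nullMeasurableSet)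
        (fun m n hmn ρ hρ => ⟨hρ.1, fun k hk => hρ.2 k (hk.trans_le hmn)⟩)
        ⟨0, measure_ne_top _ _⟩
    rw [Measure.restrict_apply hEm, Measure.restrict_apply hEm]
    refine tendsto_nhds_unique_of_eventuallyEq (htend _) (htend _) ?_
    filter_upwards [eventually_gt_atTop (s.sup id)] with n hn
    refine hP.apply_inter_Cyl_compl_congr hP' hB hκ n hEm (fun ρ ρ' h => ?_) μ
    have hs : s.restrict ρ = s.restrict ρ' :=
      funext fun i => h i ((Finset.le_sup (f := id) i.2).trans_lt hn)
    simp only [mem_cylinder, hs]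
  exact ext_of_generate_finite _ generateFrom_measurableCylinders.symm
    isPiSystem_measurableCylinders key (key _ (univ_mem_measurableCylinders _))

end IsPathMeasure

/-- Making `B` absorbing: if `κ_B` agrees with `κ` outside `B` and is the Dirac kernel on
`B`, with respective path measures `P` and `PB`, then for every initial probability `μ`:
(i) `P^κ_μ(F B) = P^{κ_B}_μ(FG B)`, and
(ii) for every measurable `A` disjoint from `B`, `P^κ_μ(G (S∖B) ∩ GF A) ≤ P^{κ_B}_μ(GF A)`. -/
theorem absorbing_kernel_properties
    {S : Type*} [MeasurableSpace S] (κ κB : Kernel S S)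
    [IsMarkovKernel κ] [IsMarkovKernel κB]
    (B : Set S) (hB : MeasurableSet B)
    (hκB_in : ∀ s ∈ B, κB s = Measure.dirac s)
    (hκB_out : ∀ s ∉ B, κB s = κ s)
    (P : Measure S → Measure (ℕ → S)) (hP : IsPathMeasure κ P)
    (PB : Measure S → Measure (ℕ → S)) (hPB : IsPathMeasure κB PB)
    (μ : Measure S) (hμ : IsProbabilityMeasure μ) :
    P μ (FEv B) = PB μ (FGEv B) ∧
    ∀ A : Set S, MeasurableSet A → A ∩ B = ∅ →
      P μ (GEv Bᶜ ∩ GFEv A) ≤ PB μ (GFEv A) := by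
  have hG : MeasurableSet (GEv Bᶜ) := by
    simp only [GEv, ofPred_forall]
    exact .iInter fun n => measurable_pi_apply n hB.compl
  have hF : FEv B = (GEv Bᶜ)ᶜ := by
    ext ρ
    simp [FEv, GEv]
  have hres := hP.restrict_GEv_compl_congr hPB hB hκB_out μ
  have := hP.1 μ hμ
  have := hPB.1 μ hμ
  constructor
  · rw [hPB.apply_FGEv_of_absorbing hB hκB_in μ, hF, prob_compl_eq_one_sub hG,
      prob_compl_eq_one_sub hG, ← Measure.restrict_apply_univ, hres, Measure.restrict_apply_univ]
  · intro A _ _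
    rw [inter_comm, ← Measure.restrict_apply' hG, hres]
    exact Measure.restrict_apply_le _ _
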